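/- Let k ≥ 1, λ ∈ (0,1/2) and γ ∈ ℝ, and let (l_j) be a sequence as in the Cantor-type construction which additionally satisfies l_j − 2·l_{j+1} < l_{j−1} − 2·l_j for every j ≥ 1 and c₁·λ^j·j^γ ≤ l_j ≤ c₂·λ^j·j^γ for every j ≥ 1, for some constants 0 < c₁ ≤ c₂. Set 𝔇 = k·log 2 / log(1/λ). Let μ be a Borel probability measure on ℝ such that μ(I) = 2^{−m} for every generation-m interval I of the construction, and let μ^k be the k-fold product measure on ℝ^k. Then there exist C > 0 and t₀ ∈ (0,1/2) such that μ^k(B(x,t)) ≤ C·t^{𝔇}·(log(1/t))^{−γ𝔇} for every x ∈ ℝ^k and every t ∈ (0,t₀), where B(x,t) denotes the open Euclidean ball of radius t. -/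

import Mathlib

open MeasureTheory Real
open scoped ENNReal

noncomputable section

/-- Left endpoint of the generation-`m` interval of the Cantor-type construction
selected by the sequence of bits `σ` (bit `i` chooses the right child at step `i`). -/
def cantorLeft (l : ℕ → ℝ) (m : ℕ) (σ : ℕ → Bool) : ℝ :=
  -(1 / 2) + ∑ i ∈ Finset.range m, (if σ i then l i - l (i + 1) else 0)

/-- The set of left endpoints of the generation-`m` intervals. -/
def cantorEndpoints (l : ℕ → ℝ) : ℕ → Finset ℝ
  | 0 => {-(1 / 2)}
  | m + 1 => cantorEndpoints l m ∪ (cantorEndpoints l m).image (· + (l m - l (m + 1)))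

lemma mem_cantorEndpoints_succ {l : ℕ → ℝ} {m : ℕ} {x : ℝ} :
    x ∈ cantorEndpoints l (m + 1) ↔ x ∈ cantorEndpoints l m ∨
      ∃ y ∈ cantorEndpoints l m, y + (l m - l (m + 1)) = x := by
  simp only [cantorEndpoints, Finset.mem_union, Finset.mem_image]

lemma exists_cantorLeft_of_mem_cantorEndpoints {l : ℕ → ℝ} {m : ℕ} {x : ℝ}
    (hx : x ∈ cantorEndpoints l m) : ∃ σ, x = cantorLeft l m σ := by
  induction m generalizing x with
  | zero => exact ⟨fun _ => false, by simpa [cantorEndpoints, cantorLeft] using hx⟩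
  | succ m ih =>
    have key : ∀ (σ : ℕ → Bool) (b : Bool), cantorLeft l (m + 1) (Function.update σ m b) =
        cantorLeft l m σ + if b then l m - l (m + 1) else 0 := by
      intro σ b
      have hcongr : ∀ i ∈ Finset.range m,
          (if Function.update σ m b i then l i - l (i + 1) else 0) =
            if σ i then l i - l (i + 1) else 0 := by
        intro i hi
        rw [Function.update_of_ne (Finset.mem_range.1 hi).ne]
      rw [cantorLeft, cantorLeft, Finset.sum_range_succ, Finset.sum_congr rfl hcongr,
        Function.update_self, add_assoc]
    rcases mem_cantorEndpoints_succ.1 hx with h | ⟨y, hy, rfl⟩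
    · obtain ⟨σ, rfl⟩ := ih h
      exact ⟨Function.update σ m false, by simp [key]⟩
    · obtain ⟨σ, rfl⟩ := ih hy
      exact ⟨Function.update σ m true, by simp [key]⟩

lemma cantorEndpoints_separated {l : ℕ → ℝ} (hlpos : ∀ j, 0 < l j)
    (hl2 : ∀ j, 2 * l (j + 1) < l j) {m : ℕ} {x y : ℝ} (hx : x ∈ cantorEndpoints l m)
    (hy : y ∈ cantorEndpoints l m) (hxy : x < y) : x + l m < y := by
  induction m generalizing x y with
  | zero =>
    simp only [cantorEndpoints, Finset.mem_singleton] at hx hy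
    linarith
  | succ m ih =>
    have h2 := hl2 m
    have hp := hlpos (m + 1)
    rcases mem_cantorEndpoints_succ.1 hx with hx' | ⟨x', hx', rfl⟩ <;>
    rcases mem_cantorEndpoints_succ.1 hy with hy' | ⟨y', hy', rfl⟩
    · linarith [ih hx' hy' hxy]
    · rcases lt_trichotomy x y' with h | h | h
      · linarith
      · linarith
      · linarith [ih hy' hx' h]
    · rcases lt_trichotomy x' y with h | h | h
      · linarith [ih hx' hy' h]
      · linarith
      · linarith
    · linarith [ih hx' hy' (by linarith)]

lemma card_cantorEndpoints {l : ℕ → ℝ} (hlpos : ∀ j, 0 < l j)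
    (hl2 : ∀ j, 2 * l (j + 1) < l j) (m : ℕ) : (cantorEndpoints l m).card = 2 ^ m := by
  induction m with
  | zero => simp [cantorEndpoints]
  | succ m ih =>
    have h2 := hl2 m
    have hp := hlpos (m + 1)
    rw [cantorEndpoints, Finset.card_union_of_disjoint,
      Finset.card_image_of_injective _ (add_left_injective _), ih, pow_succ, mul_two]
    rw [Finset.disjoint_left]
    intro x hx hx'
    obtain ⟨y, hy, rfl⟩ := Finset.mem_image.1 hx'
    linarith [cantorEndpoints_separated hlpos hl2 hy hx (by linarith)]

lemma measure_Ioo_le_of_length_le {l : ℕ → ℝ} (hlpos : ∀ j, 0 < l j)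
    (hl2 : ∀ j, 2 * l (j + 1) < l j) {μ : Measure ℝ} [IsProbabilityMeasure μ]
    (hμ : ∀ (m : ℕ) (σ : ℕ → Bool),
      μ (Set.Icc (cantorLeft l m σ) (cantorLeft l m σ + l m)) = ((2 : ℝ≥0∞) ^ m)⁻¹)
    {m : ℕ} {a b : ℝ} (hab : b - a ≤ l m) :
    μ (Set.Ioo a b) ≤ 2 * ((2 : ℝ≥0∞) ^ m)⁻¹ := by
  set E := cantorEndpoints l m with hE
  have hsep : ∀ x ∈ E, ∀ y ∈ E, x < y → x + l m < y := fun x hx y hy =>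
    cantorEndpoints_separated hlpos hl2 hx hy
  have hmass : ∀ x ∈ E, μ (Set.Icc x (x + l m)) = ((2 : ℝ≥0∞) ^ m)⁻¹ := by
    intro x hx
    obtain ⟨σ, rfl⟩ := exists_cantorLeft_of_mem_cantorEndpoints hx
    exact hμ m σ
  have hdisj : (E : Set ℝ).PairwiseDisjoint fun x => Set.Icc x (x + l m) := by
    intro x hx y hy hxy
    refine Set.disjoint_left.2 fun z hz hz' => ?_
    rcases lt_or_gt_of_ne hxy with h | h
    · linarith [hsep x hx y hy h, hz.2, hz'.1]
    · linarith [hsep y hy x hx h, hz.1, hz'.2]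
  have hone : μ (⋃ x ∈ E, Set.Icc x (x + l m)) = 1 := by
    rw [measure_biUnion_finset hdisj fun _ _ => measurableSet_Icc, Finset.sum_congr rfl hmass,
      Finset.sum_const, card_cantorEndpoints hlpos hl2, nsmul_eq_mul]
    push_cast
    exact ENNReal.mul_inv_cancel (by simp) (by simp)
  have hnull : μ (⋃ x ∈ E, Set.Icc x (x + l m))ᶜ = 0 :=
    (prob_compl_eq_zero_iff (Finset.measurableSet_biUnion _ fun _ _ => measurableSet_Icc)).2 hone
  classical
  set F := E.filter fun x => x < b ∧ a < x + l m with hF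
  have hcard : F.card ≤ 2 := by
    by_contra! hlt
    obtain ⟨x, y, z, hx, hy, hz, hxy, hxz, hyz⟩ := Finset.two_lt_card_iff.1 hlt
    simp only [hF, Finset.mem_filter] at hx hy hz
    have hxy1 := hsep x hx.1 y hy.1
    have hyx1 := hsep y hy.1 x hx.1
    have hxz1 := hsep x hx.1 z hz.1
    have hzx1 := hsep z hz.1 x hx.1
    have hyz1 := hsep y hy.1 z hz.1
    have hzy1 := hsep z hz.1 y hy.1
    rcases lt_or_gt_of_ne hxy with h1 | h1 <;> rcases lt_or_gt_of_ne hxz with h2 | h2 <;>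
      rcases lt_or_gt_of_ne hyz with h3 | h3 <;> grind
  have hcover : Set.Ioo a b ⊆ (⋃ x ∈ F, Set.Icc x (x + l m)) ∪
      (⋃ x ∈ E, Set.Icc x (x + l m))ᶜ := by
    intro z hz
    by_cases h : z ∈ ⋃ x ∈ E, Set.Icc x (x + l m)
    · left
      simp only [Set.mem_iUnion, exists_prop] at h ⊢
      obtain ⟨x, hx, hzx⟩ := h
      exact ⟨x, Finset.mem_filter.2 ⟨hx, hzx.1.trans_lt hz.2, hz.1.trans_le hzx.2⟩, hzx⟩
    · exact Or.inr h
  calc μ (Set.Ioo a b)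
      ≤ μ (⋃ x ∈ F, Set.Icc x (x + l m)) + μ (⋃ x ∈ E, Set.Icc x (x + l m))ᶜ :=
        (measure_mono hcover).trans (measure_union_le _ _)
    _ = μ (⋃ x ∈ F, Set.Icc x (x + l m)) := by rw [hnull, add_zero]
    _ ≤ ∑ x ∈ F, μ (Set.Icc x (x + l m)) := measure_biUnion_finset_le _ _
    _ = F.card * ((2 : ℝ≥0∞) ^ m)⁻¹ := by
        rw [Finset.sum_congr rfl fun x hx => hmass x (Finset.mem_filter.1 hx).1,
          Finset.sum_const, nsmul_eq_mul]
    _ ≤ 2 * ((2 : ℝ≥0∞) ^ m)⁻¹ := by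
        gcongr
        exact_mod_cast hcard

lemma measure_ball_le_prod_measure_Ioo {k : ℕ} {μ : Measure ℝ}
    {ν : Measure (EuclideanSpace ℝ (Fin k))}
    (hν : ∀ s : Fin k → Set ℝ, (∀ i, MeasurableSet (s i)) →
      ν {x | ∀ i, x i ∈ s i} = ∏ i, μ (s i))
    (x : EuclideanSpace ℝ (Fin k)) (t : ℝ) :
    ν (Metric.ball x t) ≤ ∏ i, μ (Set.Ioo (x i - t) (x i + t)) := by
  rw [← hν _ fun _ => measurableSet_Ioo]
  refine measure_mono fun y hy i => ?_
  have h : |y i - x i| < t := by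
    have h1 := PiLp.norm_apply_le (y - x) i
    rw [PiLp.sub_apply, Real.norm_eq_abs] at h1
    exact h1.trans_lt (mem_ball_iff_norm.1 hy)
  rw [abs_lt] at h
  exact ⟨by linarith [h.1], by linarith [h.2]⟩

lemma length_le_half_pow {l : ℕ → ℝ} (hl0 : l 0 = 1) (hl2 : ∀ j, 2 * l (j + 1) < l j) (m : ℕ) :
    l m ≤ (1 / 2) ^ m := by
  induction m with
  | zero => simp [hl0]
  | succ m ih =>
    rw [pow_succ]
    linarith [hl2 m]

lemma rpow_le_add_rpow {a b r : ℝ} (ha : 0 < a) (har : a ≤ r) (hrb : r ≤ b) (p : ℝ) :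
    r ^ p ≤ a ^ p + b ^ p := by
  have hr : 0 < r := ha.trans_le har
  have hb : 0 < b := hr.trans_le hrb
  rcases le_total 0 p with hp | hp
  · exact (Real.rpow_le_rpow hr.le hrb hp).trans (le_add_of_nonneg_left (by positivity))
  · exact (Real.rpow_le_rpow_of_nonpos ha har hp).trans (le_add_of_nonneg_right (by positivity))

/-- At every small scale `t` there is a generation whose intervals have length at least `2t`,
and whose index is comparable to `log (1 / t)`. -/
lemma exists_generation_of_scale {lam γ : ℝ} (hlam : lam ∈ Set.Ioo (0 : ℝ) (1 / 2))
    {l : ℕ → ℝ} (hl0 : l 0 = 1) (hl2 : ∀ j, 2 * l (j + 1) < l j)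
    {c₁ : ℝ} (hc₁ : 0 < c₁) (hlow : ∀ j : ℕ, 1 ≤ j → c₁ * lam ^ j * (j : ℝ) ^ γ ≤ l j) :
    ∃ M : ℝ, 0 < M ∧ ∀ t ∈ Set.Ioo (0 : ℝ) (1 / 2), ∃ m : ℕ, 2 * t ≤ l m ∧
      lam ^ m ≤ M * t * Real.log (1 / t) ^ (-γ) := by
  obtain ⟨hlam0, hlam1⟩ := hlam
  have hlog2 : 0 < Real.log 2 := Real.log_pos one_lt_two
  have hloglam : 0 < -Real.log lam := neg_pos.2 (Real.log_neg hlam0 (by linarith))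
  set A : ℝ := |Real.log (2 / c₁)| - Real.log lam + |γ| with hA
  have hApos : 0 < A := by
    have := abs_nonneg (Real.log (2 / c₁))
    have := abs_nonneg γ
    linarith
  refine ⟨2 / (c₁ * lam) * (Real.log 2 ^ γ + A ^ γ), by positivity, fun t ht => ?_⟩
  obtain ⟨ht0, ht1⟩ := ht
  have hex : ∃ n, l n < 2 * t := by
    obtain ⟨n, hn⟩ := exists_pow_lt_of_lt_one (by linarith : (0 : ℝ) < 2 * t)
      (by norm_num : (1 / 2 : ℝ) < 1)
    exact ⟨n, (length_le_half_pow hl0 hl2 n).trans_lt hn⟩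
  classical
  obtain ⟨m, hm⟩ : ∃ m, Nat.find hex = m + 1 := by
    refine Nat.exists_eq_succ_of_ne_zero fun h => ?_
    have := Nat.find_spec hex
    rw [h, hl0] at this
    linarith
  have hlt : l (m + 1) < 2 * t := hm ▸ Nat.find_spec hex
  have hle : 2 * t ≤ l m := not_lt.1 (Nat.find_min hex (by omega))
  refine ⟨m, hle, ?_⟩
  set n : ℝ := ((m + 1 : ℕ) : ℝ) with hn
  have hn1 : 1 ≤ n := by rw [hn]; exact_mod_cast Nat.le_add_left 1 m
  have hn0 : 0 < n := by linarith
  have hlow' : c₁ * lam ^ (m + 1) * n ^ γ < 2 * t := (hlow (m + 1) (by omega)).trans_lt hlt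
  set L := Real.log (1 / t) with hL
  have hLt : L = -Real.log t := by rw [hL, one_div, Real.log_inv]
  have hLlow : Real.log 2 * n ≤ L := by
    have h1 : t ≤ (1 / 2) ^ (m + 1) := by
      rw [pow_succ]
      linarith [length_le_half_pow hl0 hl2 m]
    have h2 := Real.log_le_log ht0 h1
    rw [Real.log_pow, one_div, Real.log_inv] at h2
    rw [hLt]
    linarith
  have hLup : L ≤ A * n := by
    have h1 := Real.log_le_log (by positivity) hlow'.le
    rw [Real.log_mul (by positivity) (by positivity), Real.log_mul (by positivity) (by positivity),
      Real.log_mul (by positivity) (by positivity), Real.log_pow, Real.log_rpow hn0] at h1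
    have h2 : -(γ * Real.log n) ≤ |γ| * n := by
      have h3 : |Real.log n| ≤ n := by
        rw [abs_of_nonneg (Real.log_nonneg hn1)]
        linarith [Real.log_le_sub_one_of_pos hn0]
      calc -(γ * Real.log n) ≤ |γ * Real.log n| := neg_le_abs _
        _ = |γ| * |Real.log n| := abs_mul _ _
        _ ≤ |γ| * n := by gcongr
    have h4 : Real.log 2 - Real.log c₁ ≤ |Real.log (2 / c₁)| * n := by
      rw [← Real.log_div two_ne_zero hc₁.ne']
      exact (le_abs_self _).trans (le_mul_of_one_le_right (abs_nonneg _) hn1)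
    rw [hLt, hA]
    linarith
  have hL0 : 0 < L := (by positivity : 0 < Real.log 2 * n).trans_le hLlow
  have hratio : (L / n) ^ γ ≤ Real.log 2 ^ γ + A ^ γ :=
    rpow_le_add_rpow hlog2 ((le_div_iff₀ hn0).2 hLlow) ((div_le_iff₀ hn0).2 hLup) γ
  rw [Real.div_rpow hL0.le hn0.le, div_le_iff₀ (by positivity)] at hratio
  rw [Real.rpow_neg hL0.le, ← div_eq_mul_inv, le_div_iff₀ (by positivity)]
  calc lam ^ m * L ^ γ ≤ lam ^ m * ((Real.log 2 ^ γ + A ^ γ) * n ^ γ) := by gcongr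
    _ = (c₁ * lam ^ (m + 1) * n ^ γ) * ((Real.log 2 ^ γ + A ^ γ) / (c₁ * lam)) := by
        field_simp
        ring
    _ ≤ 2 * t * ((Real.log 2 ^ γ + A ^ γ) / (c₁ * lam)) := by gcongr
    _ = 2 / (c₁ * lam) * (Real.log 2 ^ γ + A ^ γ) * t := by ring

/-- Lemma on the Cantor measure of balls, for generalized Cantor sets with
`l_j ≍ λ^j j^γ`: for `𝔇 = k log 2 / log(1/λ)`, the `k`-fold product `μ^k` of
the Cantor measure satisfies `μ^k(B(x,t)) ≲ t^𝔇 (log(1/t))^{-γ𝔇}`. -/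
theorem statement9 (k : ℕ) (hk : 1 ≤ k) (lam γ : ℝ) (hlam : lam ∈ Set.Ioo (0 : ℝ) (1 / 2))
    (l : ℕ → ℝ) (hl0 : l 0 = 1) (hlpos : ∀ j, 0 < l j) (hl2 : ∀ j, 2 * l (j + 1) < l j)
    (hgap : ∀ j : ℕ, 1 ≤ j → l j - 2 * l (j + 1) < l (j - 1) - 2 * l j)
    (c₁ c₂ : ℝ) (hc₁ : 0 < c₁) (hc₁₂ : c₁ ≤ c₂)
    (hlow : ∀ j : ℕ, 1 ≤ j → c₁ * lam ^ j * (j : ℝ) ^ γ ≤ l j)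
    (hhigh : ∀ j : ℕ, 1 ≤ j → l j ≤ c₂ * lam ^ j * (j : ℝ) ^ γ)
    -- the Cantor measure: a Borel probability measure giving each generation-`m`
    -- interval the mass `2^{-m}`
    (μ : Measure ℝ) (hμprob : IsProbabilityMeasure μ)
    (hμ : ∀ (m : ℕ) (σ : ℕ → Bool),
      μ (Set.Icc (cantorLeft l m σ) (cantorLeft l m σ + l m)) = ((2 : ℝ≥0∞) ^ m)⁻¹)
    -- its `k`-fold product measure on `ℝ^k`
    (ν : Measure (EuclideanSpace ℝ (Fin k)))
    (hν : ∀ s : Fin k → Set ℝ, (∀ i, MeasurableSet (s i)) →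
      ν {x | ∀ i, x i ∈ s i} = ∏ i, μ (s i)) :
    ∃ C : ℝ, 0 < C ∧ ∃ t₀ ∈ Set.Ioo (0 : ℝ) (1 / 2),
      ∀ (x : EuclideanSpace ℝ (Fin k)), ∀ t ∈ Set.Ioo (0 : ℝ) t₀,
        ν (Metric.ball x t)
          ≤ ENNReal.ofReal
              (C * t ^ ((k : ℝ) * Real.log 2 / Real.log (1 / lam))
                * Real.log (1 / t) ^ (-(γ * ((k : ℝ) * Real.log 2 / Real.log (1 / lam))))) := by
  obtain ⟨M, hM, hscale⟩ := exists_generation_of_scale hlam hl0 hl2 hc₁ hlow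
  obtain ⟨hlam0, hlam1⟩ := hlam
  set d : ℝ := Real.log 2 / Real.log (1 / lam) with hd
  have hlogpos : 0 < Real.log (1 / lam) :=
    Real.log_pos ((one_lt_div hlam0).2 (by linarith))
  have hd0 : 0 < d := div_pos (Real.log_pos one_lt_two) hlogpos
  have hlamd : lam ^ d = 1 / 2 := by
    have hlog : Real.log lam * d = -Real.log 2 := by
      have h : Real.log lam = -Real.log (1 / lam) := by rw [one_div, Real.log_inv, neg_neg]
      rw [h, hd]
      field_simp
    rw [Real.rpow_def_of_pos hlam0, hlog, Real.exp_neg, Real.exp_log two_pos, one_div]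
  refine ⟨(2 * M ^ d) ^ k, by positivity, 1 / 4, by norm_num, fun x t ht => ?_⟩
  have ht0 : 0 < t := ht.1
  obtain ⟨m, hm, hlamm⟩ := hscale t ⟨ht.1, by linarith [ht.2]⟩
  have hL : 0 < Real.log (1 / t) :=
    Real.log_pos ((one_lt_div ht0).2 (by linarith [ht.2]))
  set L := Real.log (1 / t)
  have hpow : (1 / 2 : ℝ) ^ m ≤ M ^ d * t ^ d * L ^ (-(γ * d)) := by
    calc (1 / 2 : ℝ) ^ m = (lam ^ m) ^ d := by
          rw [← hlamd, ← Real.rpow_mul_natCast hlam0.le, ← Real.rpow_natCast_mul hlam0.le,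
            mul_comm]
      _ ≤ (M * t * L ^ (-γ)) ^ d := Real.rpow_le_rpow (by positivity) hlamm hd0.le
      _ = M ^ d * t ^ d * L ^ (-(γ * d)) := by
          rw [Real.mul_rpow (by positivity) (by positivity), Real.mul_rpow hM.le ht0.le,
            ← Real.rpow_mul hL.le, neg_mul]
  have hreal : (2 * (1 / 2 : ℝ) ^ m) ^ k ≤ (2 * M ^ d) ^ k * t ^ ((k : ℝ) * Real.log 2 /
      Real.log (1 / lam)) * L ^ (-(γ * ((k : ℝ) * Real.log 2 / Real.log (1 / lam)))) := by
    calc (2 * (1 / 2 : ℝ) ^ m) ^ k ≤ (2 * (M ^ d * t ^ d * L ^ (-(γ * d)))) ^ k := by gcongr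
      _ = (2 * M ^ d) ^ k * t ^ (d * k) * L ^ (-(γ * d) * k) := by
          rw [Real.rpow_mul_natCast ht0.le, Real.rpow_mul_natCast hL.le, ← mul_pow, ← mul_pow]
          ring
      _ = _ := by
          have h : (k : ℝ) * Real.log 2 / Real.log (1 / lam) = d * k := by rw [hd]; ring
          rw [h, neg_mul, mul_assoc γ]
  calc ν (Metric.ball x t) ≤ ∏ i, μ (Set.Ioo (x i - t) (x i + t)) :=
        measure_ball_le_prod_measure_Ioo hν x t
    _ ≤ ∏ _i : Fin k, (2 * ((2 : ℝ≥0∞) ^ m)⁻¹) := Finset.prod_le_prod' fun i _ =>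
        measure_Ioo_le_of_length_le hlpos hl2 hμ (by linarith)
    _ = ENNReal.ofReal ((2 * (1 / 2 : ℝ) ^ m) ^ k) := by
        rw [Finset.prod_const, Finset.card_univ, Fintype.card_fin,
          ENNReal.ofReal_pow (by positivity), ENNReal.ofReal_mul zero_le_two,
          ENNReal.ofReal_pow (by positivity), one_div, ENNReal.ofReal_inv_of_pos two_pos,
          ENNReal.inv_pow]
        simp
    _ ≤ _ := ENNReal.ofReal_le_ofReal hreal

end
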